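/- Let (W,S) be a Coxeter system of rank 3 with S = {r,s,t}, in which rt = tr (the product rt has order 2) and the orders m_{sr} of sr and m_{st} of st both satisfy m_{sr} ≥ 4 and m_{st} ≥ 4 (possibly infinite). Then none of the following four configurations occurs for any w, w₁, w₂ ∈ W: (a) w = w₁·r with ℓ(w) = ℓ(w₁)+1 and w = w₂·s·t·s with ℓ(w) = ℓ(w₂)+3; (b) w = w₁·r with ℓ(w) = ℓ(w₁)+1 and w = w₂·t·s·t with ℓ(w) = ℓ(w₂)+3; (c) w = w₁·t with ℓ(w) = ℓ(w₁)+1 and w = w₂·s·r·s with ℓ(w) = ℓ(w₂)+3; (d) w = w₁·t with ℓ(w) = ℓ(w₁)+1 and w = w₂·r·s·r with ℓ(w) = ℓ(w₂)+3. -/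

import Mathlib

open LaurentPolynomial

namespace CoxeterSystem

variable {B W : Type*} [Group W] {M : CoxeterMatrix B} (cs : CoxeterSystem M W)

open Classical in
/-- The action of a simple reflection on `W × ZMod 2`: conjugate the first entry, and flip the
second one when the first entry is that simple reflection. -/
noncomputable def signedConj (i : B) : Function.End (W × ZMod 2) := fun p =>
  (cs.simple i * p.1 * cs.simple i, p.2 + if p.1 = cs.simple i then 1 else 0)

theorem _root_.Function.End.mul_apply {α : Type*} (f g : Function.End α) (x : α) :
    (f * g) x = f (g x) := rfl

theorem simple_mul_pow (i j : B) (k : ℕ) :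
    cs.simple j * (cs.simple i * cs.simple j) ^ k =
      ((cs.simple i * cs.simple j) ^ k)⁻¹ * cs.simple j := by
  have h : SemiconjBy (cs.simple j) (cs.simple i * cs.simple j)
      (cs.simple i * cs.simple j)⁻¹ := by
    simp [SemiconjBy, mul_assoc]
  have := (h.pow_right k).eq
  rwa [inv_pow] at this

open Classical in
theorem signedConj_mul_pow_apply (i j : B) (k : ℕ) (t : W) (e : ZMod 2) :
    ((cs.signedConj i * cs.signedConj j) ^ k) (t, e) =
      ((cs.simple i * cs.simple j) ^ k * t * ((cs.simple i * cs.simple j) ^ k)⁻¹,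
        e + ∑ l ∈ Finset.range (2 * k),
          if (cs.simple i * cs.simple j) ^ l * t = cs.simple j then 1 else 0) := by
  induction k with
  | zero => simp; rfl
  | succ k ih =>
    have key := cs.simple_mul_pow i j k
    set x := cs.simple i * cs.simple j with hx
    have hxinv : x⁻¹ = cs.simple j * cs.simple i := by simp [hx]
    have h₁ : x ^ k * t * (x ^ k)⁻¹ = cs.simple j ↔ x ^ (2 * k) * t = cs.simple j := by
      rw [mul_inv_eq_iff_eq_mul, key, eq_inv_mul_iff_mul_eq, ← mul_assoc, ← pow_add, two_mul]
    have h₂ : cs.simple j * (x ^ k * t * (x ^ k)⁻¹) * cs.simple j = cs.simple i ↔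
        x ^ (2 * k + 1) * t = cs.simple j := by
      have e₁ : cs.simple j * (x ^ k * t * (x ^ k)⁻¹) * cs.simple j = cs.simple i ↔
          x ^ k * t * (x ^ k)⁻¹ = x⁻¹ * cs.simple j := by
        rw [hxinv]
        constructor
        · intro h; rw [← h]; simp [mul_assoc]
        · intro h; rw [h]; simp [mul_assoc]
      rw [e₁, mul_inv_eq_iff_eq_mul, mul_assoc, key, eq_inv_mul_iff_mul_eq,
        eq_inv_mul_iff_mul_eq, ← mul_assoc, ← mul_assoc, ← pow_succ, ← pow_add,
        show k + 1 + k = 2 * k + 1 by ring]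
    rw [pow_succ', Function.End.mul_apply, ih, Function.End.mul_apply]
    simp only [signedConj, h₁, h₂]
    rw [show 2 * (k + 1) = 2 * k + 1 + 1 by ring, Finset.sum_range_succ, Finset.sum_range_succ,
      pow_succ' x k, mul_inv_rev, hxinv]
    simp only [hx, mul_assoc, add_assoc]

theorem isLiftable_signedConj : M.IsLiftable cs.signedConj := by
  classical
  intro i j
  funext ⟨t, e⟩
  rw [signedConj_mul_pow_apply, two_mul, Finset.sum_range_add]
  simp only [pow_add, cs.simple_mul_simple_pow, one_mul, inv_one, mul_one]
  rw [CharTwo.add_self_eq_zero, add_zero]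
  rfl

/-- The action of a Coxeter group on `W × ZMod 2` whose second entry records the parity of the
multiplicity of an element in right inversion sequences. -/
noncomputable def signedConjHom : W →* Function.End (W × ZMod 2) :=
  cs.lift ⟨cs.signedConj, cs.isLiftable_signedConj⟩

open Classical in
theorem signedConjHom_wordProd_apply (ω : List B) (t : W) (e : ZMod 2) :
    cs.signedConjHom (cs.wordProd ω) (t, e) =
      (cs.wordProd ω * t * (cs.wordProd ω)⁻¹, e + ((cs.rightInvSeq ω).count t : ZMod 2)) := by
  induction ω with
  | nil => simp; rfl
  | cons i ω ih =>
    have h : cs.wordProd ω * t * (cs.wordProd ω)⁻¹ = cs.simple i ↔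
        (cs.wordProd ω)⁻¹ * cs.simple i * cs.wordProd ω = t := by
      constructor
      · intro h; rw [← h]; group
      · intro h; rw [← h]; group
    rw [wordProd_cons, map_mul, Function.End.mul_apply, ih, signedConjHom,
      lift_apply_simple]
    simp only [signedConj, h, rightInvSeq, List.count_cons, beq_iff_eq]
    simp [mul_assoc, add_assoc]

/-- The exchange condition for right descents. -/
theorem exists_eraseIdx_of_isRightDescent {ω : List B} {i : B}
    (h : cs.IsRightDescent (cs.wordProd ω) i) :
    ∃ k < ω.length, cs.wordProd ω * cs.simple i = cs.wordProd (ω.eraseIdx k) := by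
  classical
  obtain ⟨η, hη, hηw⟩ := cs.exists_isReduced (cs.wordProd ω * cs.simple i)
  have hw : cs.wordProd (η.concat i) = cs.wordProd ω := by
    rw [wordProd_concat, ← hηw]; simp
  have hred : cs.IsReduced (η.concat i) := by
    rw [IsReduced, hw, List.length_concat, ← hη.eq, ← hηw]
    exact (cs.isRightDescent_iff.1 h).symm
  have hmem : cs.simple i ∈ cs.rightInvSeq (η.concat i) := by
    rw [rightInvSeq_concat]; simp
  have hcount := List.count_eq_one_of_mem hred.nodup_rightInvSeq hmem
  have h₁ := cs.signedConjHom_wordProd_apply (η.concat i) (cs.simple i) 0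
  rw [hw, cs.signedConjHom_wordProd_apply, hcount] at h₁
  have h₂ : (((cs.rightInvSeq ω).count (cs.simple i) : ℕ) : ZMod 2) = 1 := by
    simpa using congrArg Prod.snd h₁
  have hmem' : cs.simple i ∈ cs.rightInvSeq ω := by
    by_contra hn
    rw [List.count_eq_zero_of_not_mem hn] at h₂
    exact absurd h₂ (by decide)
  obtain ⟨k, hk, hki⟩ := List.mem_iff_getElem.1 hmem'
  refine ⟨k, by simpa using hk, ?_⟩
  rw [← wordProd_mul_getD_rightInvSeq, List.getD_eq_getElem _ _ hk, hki]

/-- `w` is the product of some element and the word `ω`, with lengths adding up. -/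
def HasSuffix (w : W) (ω : List B) : Prop :=
  ∃ v, w = v * cs.wordProd ω ∧ cs.length w = cs.length v + ω.length

variable {cs} {w : W} {ω : List B} {i j k : B}

theorem HasSuffix.tail (h : cs.HasSuffix w (i :: ω)) : cs.HasSuffix w ω := by
  obtain ⟨v, hv, hl⟩ := h
  refine ⟨v * cs.simple i, by rw [hv, wordProd_cons, mul_assoc], ?_⟩
  have h₁ := cs.length_mul_le (v * cs.simple i) (cs.wordProd ω)
  have h₂ := cs.length_wordProd_le ω
  have h₃ := cs.length_mul_le v (cs.simple i)
  rw [mul_assoc, ← wordProd_cons, ← hv] at h₁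
  simp only [length_simple, List.length_cons] at *
  omega

theorem HasSuffix.of_append {η : List B} (h : cs.HasSuffix w (η ++ ω)) : cs.HasSuffix w ω := by
  induction η with
  | nil => exact h
  | cons i η ih => exact ih h.tail

theorem hasSuffix_singleton : cs.HasSuffix w [i] ↔ cs.IsRightDescent w i := by
  rw [isRightDescent_iff]
  constructor
  · rintro ⟨v, hv, hl⟩
    simp_all
  · intro h
    exact ⟨w * cs.simple i, by simp, by simpa using h.symm⟩

theorem hasSuffix_concat :
    cs.HasSuffix w (ω ++ [i]) ↔
      cs.IsRightDescent w i ∧ cs.HasSuffix (w * cs.simple i) ω := by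
  constructor
  · intro h
    have hd := hasSuffix_singleton.1 h.of_append
    refine ⟨hd, ?_⟩
    obtain ⟨v, hv, hl⟩ := h
    refine ⟨v, by simp [hv, wordProd_append, mul_assoc], ?_⟩
    have := cs.isRightDescent_iff.1 hd
    simp only [List.length_append, List.length_singleton] at hl
    omega
  · rintro ⟨hd, v, hv, hl⟩
    refine ⟨v, ?_, ?_⟩
    · rw [wordProd_append, ← mul_assoc, ← hv]; simp
    · have := cs.isRightDescent_iff.1 hd
      simp only [List.length_append, List.length_singleton]
      omega

/-- Exchange for an element with a given suffix: either the suffix can be prolonged by a right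
descent, or the exchange takes place inside the suffix. -/
theorem HasSuffix.exchange (h : cs.HasSuffix w ω) (hd : cs.IsRightDescent w i) :
    cs.HasSuffix w (ω ++ [i]) ∨
      ∃ k < ω.length, cs.wordProd ω * cs.simple i = cs.wordProd (ω.eraseIdx k) := by
  obtain ⟨v, hv, hl⟩ := h
  obtain ⟨η, hη, rfl⟩ := cs.exists_isReduced v
  rw [← wordProd_append] at hv
  have hd' := hd
  rw [hv] at hd'
  obtain ⟨k, hk, hki⟩ := cs.exists_eraseIdx_of_isRightDescent hd'
  rcases lt_or_ge k η.length with hlt | hge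
  · left
    rw [List.eraseIdx_append_of_lt_length hlt, ← hv, wordProd_append] at hki
    refine hasSuffix_concat.2 ⟨hd, _, hki, ?_⟩
    have h₁ := cs.length_mul_le (cs.wordProd (η.eraseIdx k)) (cs.wordProd ω)
    have h₂ := cs.length_wordProd_le ω
    have h₃ := cs.length_wordProd_le (η.eraseIdx k)
    have h₄ := cs.isRightDescent_iff.1 hd
    rw [List.length_eraseIdx_of_lt hlt] at h₃
    rw [← hki] at h₁
    rw [hη.eq] at hl
    omega
  · right
    rw [List.eraseIdx_append_of_length_le hge, wordProd_append, wordProd_append, mul_assoc,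
      mul_right_inj] at hki
    rw [List.length_append] at hk
    exact ⟨k - η.length, by omega, hki⟩

theorem HasSuffix.pair (hij : cs.simple j ≠ cs.simple i) (hi : cs.IsRightDescent w i)
    (hj : cs.IsRightDescent w j) : cs.HasSuffix w [j, i] := by
  rcases (hasSuffix_singleton.2 hj).exchange hi with h | ⟨k, hk, h⟩
  · exact h
  · obtain rfl : k = 0 := by simpa using hk
    simp only [wordProd_singleton, List.eraseIdx_zero, List.tail_cons, wordProd_nil] at h
    exact absurd (by simpa using mul_eq_one_iff_eq_inv.1 h) hij

theorem simple_mul_simple_pow_ne_one_symm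
    (h : ∀ n, 0 < n → n < 4 → (cs.simple i * cs.simple j) ^ n ≠ 1) :
    ∀ n, 0 < n → n < 4 → (cs.simple j * cs.simple i) ^ n ≠ 1 := by
  intro n h₀ h₄ hn
  refine h n h₀ h₄ ?_
  rw [← inv_inj, ← inv_pow, mul_inv_rev, inv_simple, inv_simple, hn, inv_one]

theorem HasSuffix.alternating_four
    (hij : ∀ n, 0 < n → n < 4 → (cs.simple j * cs.simple i) ^ n ≠ 1)
    (hi : cs.IsRightDescent w i) (hj : cs.IsRightDescent w j) :
    cs.HasSuffix w [j, i, j, i] := by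
  have h₁ := hij 1 (by norm_num) (by norm_num)
  have h₂ := hij 2 (by norm_num) (by norm_num)
  have h₃ := hij 3 (by norm_num) (by norm_num)
  rw [pow_one] at h₁
  rw [pow_two] at h₂
  rw [pow_succ, pow_two] at h₃
  have hne : cs.simple j ≠ cs.simple i := by
    intro h
    exact h₁ (by rw [h, simple_mul_simple_self])
  have hji : cs.HasSuffix w [j, i, j] := by
    rcases (HasSuffix.pair hne hi hj).exchange hj with h | ⟨k, hk, h⟩
    · exact h
    · exfalso
      simp only [List.length_cons, List.length_nil] at hk
      interval_cases k
      · simp only [wordProd_cons, wordProd_nil, mul_one, List.eraseIdx_zero, List.tail_cons] at h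
        exact h₂ (by rw [← mul_assoc, h, simple_mul_simple_self])
      · simp only [wordProd_cons, wordProd_nil, mul_one, List.eraseIdx_cons_succ,
          List.eraseIdx_zero, List.tail_cons, mul_assoc, mul_eq_left] at h
        exact hne (by simpa using (mul_eq_one_iff_eq_inv.1 h).symm)
  rcases hji.exchange hi with h | ⟨k, hk, h⟩
  · exact h
  · exfalso
    simp only [List.length_cons, List.length_nil] at hk
    interval_cases k
    · simp only [wordProd_cons, wordProd_nil, mul_one, List.eraseIdx_zero, List.tail_cons] at h
      refine h₃ ?_
      calc _ = cs.simple j * (cs.simple i * cs.simple j) * cs.simple i *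
            (cs.simple j * cs.simple i) := by simp only [mul_assoc]
        _ = 1 := by rw [h]; simp [mul_assoc]
    · simp only [wordProd_cons, wordProd_nil, mul_one, List.eraseIdx_cons_succ,
        List.eraseIdx_zero, List.tail_cons, simple_mul_simple_self] at h
      exact h₂ (by rw [← h]; simp only [mul_assoc])
    · simp only [wordProd_cons, wordProd_nil, mul_one, List.eraseIdx_cons_succ,
        List.eraseIdx_zero, List.tail_cons, mul_assoc, mul_right_inj, mul_eq_left] at h
      exact h₁ h

/-- If `s i` and `s k` commute and `s j` is far from commuting with both, then no element has both
`s j * s i * s j` and `s j * s k * s j` as suffixes. -/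
theorem not_hasSuffix_both (hik : Commute (cs.simple i) (cs.simple k))
    (hne : cs.simple i ≠ cs.simple k)
    (hi : ∀ n, 0 < n → n < 4 → (cs.simple j * cs.simple i) ^ n ≠ 1)
    (hk : ∀ n, 0 < n → n < 4 → (cs.simple j * cs.simple k) ^ n ≠ 1) (w : W)
    (hwi : cs.HasSuffix w [j, i, j]) : ¬ cs.HasSuffix w [j, k, j] := by
  intro hwk
  obtain ⟨hd, hxi⟩ := hasSuffix_concat (ω := [j, i]).1 hwi
  obtain ⟨-, hxk⟩ := hasSuffix_concat (ω := [j, k]).1 hwk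
  obtain ⟨hdi, hji⟩ := hasSuffix_concat (ω := [j]).1 hxi
  obtain ⟨hdk, hjk⟩ := hasSuffix_concat (ω := [j]).1 hxk
  rw [hasSuffix_singleton] at hji hjk
  have hki := hasSuffix_singleton.1
    (hasSuffix_concat (ω := [k]).1 (HasSuffix.pair hne.symm hdi hdk)).2
  have hik' := hasSuffix_singleton.1
    (hasSuffix_concat (ω := [i]).1 (HasSuffix.pair hne hdk hdi)).2
  have hvk := (hasSuffix_concat (ω := [j, k, j]).1 (HasSuffix.alternating_four hk hki hji)).2
  have hvi := (hasSuffix_concat (ω := [j, i, j]).1 (HasSuffix.alternating_four hi hik' hjk)).2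
  rw [mul_assoc _ (cs.simple k), ← hik.eq, ← mul_assoc] at hvi
  have : cs.length (w * cs.simple j * cs.simple i * cs.simple k) < cs.length w :=
    lt_trans hki (lt_trans hdi hd)
  exact not_hasSuffix_both hik hne hi hk _ hvi hvk
termination_by cs.length w

/-- If `s i` and `s k` commute and `s j` is far from commuting with both, then no element with
right descent `s i` has `s j * s k * s j` as a suffix. -/
theorem IsRightDescent.not_hasSuffix_outer (hik : Commute (cs.simple i) (cs.simple k))
    (hne : cs.simple i ≠ cs.simple k)
    (hi : ∀ n, 0 < n → n < 4 → (cs.simple j * cs.simple i) ^ n ≠ 1)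
    (hk : ∀ n, 0 < n → n < 4 → (cs.simple j * cs.simple k) ^ n ≠ 1)
    (hd : cs.IsRightDescent w i) : ¬ cs.HasSuffix w [j, k, j] := by
  intro hw
  have hj := hasSuffix_singleton.1 (HasSuffix.of_append (η := [j, k]) hw)
  have h := HasSuffix.alternating_four (simple_mul_simple_pow_ne_one_symm hi) hj hd
  exact not_hasSuffix_both hik hne hi hk w h.tail hw

/-- If `s i` and `s k` commute and `s j` is far from commuting with both, then no element with
right descent `s i` has `s k * s j * s k` as a suffix. -/
theorem IsRightDescent.not_hasSuffix_inner (w : W) (i k : B)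
    (hik : Commute (cs.simple i) (cs.simple k)) (hne : cs.simple i ≠ cs.simple k)
    (hi : ∀ n, 0 < n → n < 4 → (cs.simple j * cs.simple i) ^ n ≠ 1)
    (hk : ∀ n, 0 < n → n < 4 → (cs.simple j * cs.simple k) ^ n ≠ 1)
    (hd : cs.IsRightDescent w i) : ¬ cs.HasSuffix w [k, j, k] := by
  intro hw
  obtain ⟨hdk, hkj⟩ := hasSuffix_concat (ω := [k, j]).1 hw
  have hdi := hasSuffix_singleton.1
    (hasSuffix_concat (ω := [i]).1 (HasSuffix.pair hne hdk hd)).2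
  obtain ⟨hdj, hk'⟩ := hasSuffix_concat (ω := [k]).1 hkj
  have h := HasSuffix.alternating_four (simple_mul_simple_pow_ne_one_symm hi) hdj hdi
  have hv := (hasSuffix_concat (ω := [i, j, i]).1 h).2
  have : cs.length (w * cs.simple k * cs.simple j) < cs.length w := lt_trans hdj hdk
  exact IsRightDescent.not_hasSuffix_inner _ k i hik.symm hne.symm hk hi
    (hasSuffix_singleton.1 hk') hv
termination_by cs.length w

end CoxeterSystem

/-- Lemma 4.3: if `m_{sr}, m_{st} ≥ 4`, none of the configurations
`w = (w₁)(r) = (w₂)(sts)`, `w = (w₁)(r) = (w₂)(tst)`, `w = (w₁)(t) = (w₂)(srs)`,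
`w = (w₁)(t) = (w₂)(rsr)` occurs. -/
theorem no_element_four_configurations
{W : Type*} [Group W] {M : CoxeterMatrix (Fin 3)} (cs : CoxeterSystem M W)
    (r s t : W) (hr : r = cs.simple 0) (hs : s = cs.simple 1) (ht : t = cs.simple 2)
    (hrt : orderOf (r * t) = 2)
    (hsr : orderOf (s * r) = 0 ∨ 4 ≤ orderOf (s * r))
    (hst : orderOf (s * t) = 0 ∨ 4 ≤ orderOf (s * t)) :
    ¬ ∃ w w1 w2 : W,
        (w = w1 * r ∧ cs.length w = cs.length w1 + 1 ∧
          w = w2 * s * t * s ∧ cs.length w = cs.length w2 + 3) ∨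
        (w = w1 * r ∧ cs.length w = cs.length w1 + 1 ∧
          w = w2 * t * s * t ∧ cs.length w = cs.length w2 + 3) ∨
        (w = w1 * t ∧ cs.length w = cs.length w1 + 1 ∧
          w = w2 * s * r * s ∧ cs.length w = cs.length w2 + 3) ∨
        (w = w1 * t ∧ cs.length w = cs.length w1 + 1 ∧
          w = w2 * r * s * r ∧ cs.length w = cs.length w2 + 3) := by
  subst hr hs ht
  have hcomm : Commute (cs.simple 0) (cs.simple 2) := by
    have h := pow_orderOf_eq_one (cs.simple 0 * cs.simple 2)
    rw [hrt, pow_two] at h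
    simpa [commute_iff_eq] using mul_eq_one_iff_eq_inv.1 h
  have hne : cs.simple 0 ≠ cs.simple 2 := by
    intro h
    rw [h, cs.simple_mul_simple_self, orderOf_one] at hrt
    omega
  have pow_ne {x : W} (hx : orderOf x = 0 ∨ 4 ≤ orderOf x) :
      ∀ n, 0 < n → n < 4 → x ^ n ≠ 1 := by
    intro n h₀ h₄ hn
    have hdvd := orderOf_dvd_of_pow_eq_one hn
    rcases hx with hx | hx
    · rw [hx, zero_dvd_iff] at hdvd
      omega
    · have := Nat.le_of_dvd h₀ hdvd
      omega
  have hr := pow_ne hsr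
  have ht := pow_ne hst
  have descent {w v : W} {i : Fin 3} (h : w = v * cs.simple i)
      (hl : cs.length w = cs.length v + 1) : cs.IsRightDescent w i :=
    CoxeterSystem.hasSuffix_singleton.1 ⟨v, by simpa using h, hl⟩
  have suffix {w v : W} {i j : Fin 3} (h : w = v * cs.simple i * cs.simple j * cs.simple i)
      (hl : cs.length w = cs.length v + 3) : cs.HasSuffix w [i, j, i] :=
    ⟨v, by simpa [CoxeterSystem.wordProd_cons, mul_assoc] using h, hl⟩
  rintro ⟨w, w1, w2, ⟨h, hl, h', hl'⟩ | ⟨h, hl, h', hl'⟩ | ⟨h, hl, h', hl'⟩ | ⟨h, hl, h', hl'⟩⟩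
  · exact (descent h hl).not_hasSuffix_outer hcomm hne hr ht (suffix h' hl')
  · exact (descent h hl).not_hasSuffix_inner _ _ _ hcomm hne hr ht (suffix h' hl')
  · exact (descent h hl).not_hasSuffix_outer hcomm.symm hne.symm ht hr (suffix h' hl')
  · exact (descent h hl).not_hasSuffix_inner _ _ _ hcomm.symm hne.symm ht hr (suffix h' hl')
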